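/- For every α > 0, every nilpotent subgroup of the group of orientation-preserving C^{1+α} diffeomorphisms of ℝ admits a nonempty minimal closed invariant subset of ℝ. -/

import Mathlib

open Set MeasureTheory
open scoped NNReal

/-- Orientation-preserving homeomorphisms of ℝ, modelled as order-isomorphisms of ℝ
(every order-isomorphism of ℝ is a strictly increasing homeomorphism and conversely). -/
abbrev HomeoR := ℝ ≃o ℝ

/-- The fixed point set of `f`. -/
def FixSet (f : HomeoR) : Set ℝ := {x : ℝ | f x = x}

/-- `f` and `g` are crossed with `f` in the distinguished role: there is an interval
`(a,b)` with endpoints possibly `±∞` such that `Fix(f) ∩ [a,b] = {a,b}` while `g`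
maps `a` or `b` into `(a,b)`. -/
def CrossedAt (f g : HomeoR) : Prop :=
  ∃ a b : EReal, a < b ∧
    ({x : ℝ | a ≤ (x : EReal) ∧ (x : EReal) ≤ b} ∩ FixSet f
      = {x : ℝ | (x : EReal) = a ∨ (x : EReal) = b}) ∧
    (∃ x : ℝ, ((x : EReal) = a ∨ (x : EReal) = b) ∧
      a < (g x : EReal) ∧ (g x : EReal) < b)

/-- Two elements are crossed. -/
def Crossed (f g : HomeoR) : Prop := CrossedAt f g ∨ CrossedAt g f

/-- `μ` is a (nonzero) `G`-invariant Radon measure on ℝ. -/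
def InvariantRadon (G : Subgroup HomeoR) (μ : Measure ℝ) : Prop :=
  μ ≠ 0 ∧ IsFiniteMeasureOnCompacts μ ∧ ∀ g ∈ G, Measure.map (⇑g) μ = μ

/-- `Λ` is a nonempty minimal closed `G`-invariant subset of ℝ. -/
def MinimalSet (G : Subgroup HomeoR) (Λ : Set ℝ) : Prop :=
  Λ.Nonempty ∧ IsClosed Λ ∧ (∀ g ∈ G, ⇑g '' Λ = Λ) ∧
    ∀ Λ' ⊆ Λ, Λ'.Nonempty → IsClosed Λ' → (∀ g ∈ G, ⇑g '' Λ' = Λ') → Λ' = Λ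


/-- Summing over the simplices `{n | ∑ n i = t}` against the weights `n i`. -/
lemma sum_piAntidiag_succ (k t : ℕ) (g : (ℕ → ℕ) → ℝ) :
    ∑ n ∈ (Finset.range k).piAntidiag (t + 1), ∑ i ∈ Finset.range k,
        (n i : ℝ) * g (n - Pi.single i 1) =
      (t + k) * ∑ n ∈ (Finset.range k).piAntidiag t, g n := by
  have key : ∀ i ∈ Finset.range k,
      ∑ n ∈ (Finset.range k).piAntidiag (t + 1), (n i : ℝ) * g (n - Pi.single i 1) =
        ∑ n ∈ (Finset.range k).piAntidiag t, ((n i : ℝ) + 1) * g n := by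
    intro i hi
    symm
    refine Finset.sum_of_injOn (fun n => n + Pi.single i 1) ?_ ?_ ?_ ?_
    · intro n _ m _ h
      exact add_right_cancel h
    · intro n hn
      simp only [Finset.mem_coe, Finset.mem_piAntidiag] at hn ⊢
      refine ⟨?_, fun j hj => ?_⟩
      · simp only [Pi.add_apply, Finset.sum_add_distrib, hn.1,
          Pi.single_apply]
        simp [Finset.mem_range.1 hi]
      · by_cases hji : j = i
        · exact hji ▸ hi
        · exact hn.2 j (by simpa [hji] using hj)
    · intro n hn hni
      by_cases h0 : n i = 0
      · simp [h0]
      · refine absurd ⟨n - Pi.single i 1, ?_, ?_⟩ hni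
        · simp only [Finset.mem_coe, Finset.mem_piAntidiag] at hn ⊢
          have hadd : n = (n - Pi.single i 1) + Pi.single i 1 := by
            ext j
            by_cases hji : j = i
            · subst hji; simp; omega
            · simp [hji]
          refine ⟨?_, fun j hj => hn.2 j fun h => hj (by simp [h])⟩
          have h1 := hn.1
          rw [hadd] at h1
          simp only [Pi.add_apply, Finset.sum_add_distrib, Pi.single_apply] at h1
          simp only [Finset.sum_ite_eq', hi, if_true, add_left_inj] at h1
          simpa [Pi.single_apply] using h1
        · ext j
          by_cases hji : j = i
          · subst hji; simp; omega
          · simp [hji]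
    · intro n _
      simp
  rw [Finset.sum_comm, Finset.sum_congr rfl key, Finset.sum_comm, Finset.mul_sum]
  refine Finset.sum_congr rfl fun n hn => ?_
  rw [← Finset.sum_mul, Finset.sum_add_distrib]
  have : (∑ i ∈ Finset.range k, (n i : ℝ)) = t := by
    exact_mod_cast (Finset.mem_piAntidiag.1 hn).1
  simp [this]

lemma succ_mul_card_piAntidiag (k t : ℕ) :
    ((t : ℝ) + 1) * ((Finset.range k).piAntidiag (t + 1)).card =
      (t + k) * ((Finset.range k).piAntidiag t).card := by
  have h := sum_piAntidiag_succ k t fun _ => 1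
  simp only [mul_one, Finset.sum_const, nsmul_eq_mul] at h
  rw [← h, mul_comm, ← nsmul_eq_mul, ← Finset.sum_const]
  refine Finset.sum_congr rfl fun n hn => ?_
  exact_mod_cast (Finset.mem_piAntidiag.1 hn).1.symm

lemma card_piAntidiag_range (r t : ℕ) :
    ((Finset.range (r + 1)).piAntidiag t).card = (t + r).choose r := by
  induction t with
  | zero => simp
  | succ t ih =>
    have h := succ_mul_card_piAntidiag (r + 1) t
    have h2 := Nat.choose_mul_succ_eq (t + r) r
    rw [ih] at h
    have h' : (t + 1) * ((Finset.range (r + 1)).piAntidiag (t + 1)).card =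
        (t + (r + 1)) * (t + r).choose r := by exact_mod_cast h
    have e : t + r + 1 - r = t + 1 := by omega
    rw [e] at h2
    have : (t + 1) * ((Finset.range (r + 1)).piAntidiag (t + 1)).card =
        (t + 1) * (t + 1 + r).choose r := by
      rw [h', show t + 1 + r = t + r + 1 by ring, mul_comm (t + 1), ← h2]
      ring
    exact Nat.eq_of_mul_eq_mul_left (by omega) this

/-- The expected cost of a random monotone lattice path from `0` to a point `n` with
coordinate sum `t`, each visited point `m` other than `n` costing `v m`. -/
noncomputable def averageCost (k : ℕ) (v : (ℕ → ℕ) → ℝ) : ℕ → (ℕ → ℕ) → ℝ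
  | 0, _ => 0
  | t + 1, n => ∑ i ∈ Finset.range k, (n i : ℝ) / (t + 1) *
      (averageCost k v t (n - Pi.single i 1) + v (n - Pi.single i 1))

lemma exists_le_averageCost (k : ℕ) (v : (ℕ → ℕ) → ℝ) (Q : (ℕ → ℕ) → ℝ → Prop) (h0 : Q 0 0)
    (hstep : ∀ n s i, i < k → Q n s → Q (n + Pi.single i 1) (s + v n)) (t : ℕ) :
    ∀ n ∈ (Finset.range k).piAntidiag t, ∃ s ≤ averageCost k v t n, Q n s := by
  induction t with
  | zero =>
    intro n hn
    rw [Finset.piAntidiag_zero, Finset.mem_singleton] at hn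
    exact ⟨0, le_rfl, hn ▸ h0⟩
  | succ t ih =>
    intro n hn
    obtain ⟨hsum, hsupp⟩ := Finset.mem_piAntidiag.1 hn
    have ht : (0 : ℝ) < t + 1 := by positivity
    obtain ⟨i, hi, hni, hle⟩ : ∃ i ∈ Finset.range k, n i ≠ 0 ∧
        averageCost k v t (n - Pi.single i 1) + v (n - Pi.single i 1) ≤
          averageCost k v (t + 1) n := by
      by_contra! hcon
      have hex : ∃ i ∈ Finset.range k, n i ≠ 0 := by
        by_contra! h
        rw [Finset.sum_eq_zero h] at hsum
        omega
      obtain ⟨j, hj, hnj⟩ := hex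
      have hlt : ∑ i ∈ Finset.range k, (n i : ℝ) / (t + 1) * averageCost k v (t + 1) n <
          averageCost k v (t + 1) n := by
        conv_rhs => rw [averageCost]
        refine Finset.sum_lt_sum (fun i hi => ?_) ⟨j, hj, ?_⟩
        · by_cases h : n i = 0
          · simp [h]
          · exact mul_le_mul_of_nonneg_left (hcon i hi h).le (by positivity)
        · have : (0 : ℝ) < n j := by exact_mod_cast Nat.pos_of_ne_zero hnj
          exact mul_lt_mul_of_pos_left (hcon j hj hnj) (by positivity)
      rw [← Finset.sum_mul, ← Finset.sum_div] at hlt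
      have hs : (∑ i ∈ Finset.range k, (n i : ℝ)) = t + 1 := by exact_mod_cast hsum
      rw [hs, div_self ht.ne', one_mul] at hlt
      exact lt_irrefl _ hlt
    have hadd : n = (n - Pi.single i 1) + Pi.single i 1 := by
      ext j
      by_cases hji : j = i
      · subst hji; simp; omega
      · simp [hji]
    have hmem : n - Pi.single i 1 ∈ (Finset.range k).piAntidiag t := by
      refine Finset.mem_piAntidiag.2 ⟨?_, fun j hj => hsupp j fun h => hj (by simp [h])⟩
      rw [hadd] at hsum
      simp only [Pi.add_apply, Finset.sum_add_distrib, Pi.single_apply] at hsum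
      simp only [Finset.sum_ite_eq', hi, if_true, add_left_inj] at hsum
      simpa [Pi.single_apply] using hsum
    obtain ⟨s, hs, hQ⟩ := ih _ hmem
    refine ⟨s + v (n - Pi.single i 1), by linarith, ?_⟩
    have := hstep _ _ i (Finset.mem_range.1 hi) hQ
    rwa [← hadd] at this

lemma sum_averageCost (r : ℕ) (v : (ℕ → ℕ) → ℝ) (t : ℕ) :
    ∑ n ∈ (Finset.range (r + 1)).piAntidiag t, averageCost (r + 1) v t n =
      ((Finset.range (r + 1)).piAntidiag t).card * ∑ s ∈ Finset.range t,
        (∑ n ∈ (Finset.range (r + 1)).piAntidiag s, v n) /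
          ((Finset.range (r + 1)).piAntidiag s).card := by
  induction t with
  | zero => simp [averageCost]
  | succ t ih =>
    have ht : (0 : ℝ) < t + 1 := by positivity
    have hc := succ_mul_card_piAntidiag (r + 1) t
    have hpos : (0 : ℝ) < ((Finset.range (r + 1)).piAntidiag t).card := by
      rw [card_piAntidiag_range]
      exact_mod_cast Nat.choose_pos (by omega)
    have h := sum_piAntidiag_succ (r + 1) t fun n => averageCost (r + 1) v t n + v n
    rw [Finset.sum_add_distrib, ih] at h
    rw [Finset.sum_range_succ]
    have h2 : ∑ n ∈ (Finset.range (r + 1)).piAntidiag (t + 1), averageCost (r + 1) v (t + 1) n =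
        (∑ n ∈ (Finset.range (r + 1)).piAntidiag (t + 1), ∑ i ∈ Finset.range (r + 1),
          (n i : ℝ) * (averageCost (r + 1) v t (n - Pi.single i 1) + v (n - Pi.single i 1))) /
            (t + 1) := by
      simp only [averageCost, Finset.sum_div]
      refine Finset.sum_congr rfl fun n _ => Finset.sum_congr rfl fun i _ => ?_
      ring
    rw [h2, h, div_eq_iff ht.ne']
    have hc' : (((Finset.range (r + 1)).piAntidiag (t + 1)).card : ℝ) =
        (t + (r + 1 : ℕ)) * ((Finset.range (r + 1)).piAntidiag t).card / (t + 1) := by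
      rw [← hc]; field_simp
    rw [hc']
    field_simp

/-- If the lengths `ℓ n` of the cells of an `(r+1)`-dimensional lattice octant are summable and
`r * β ≥ 2`, then there are monotone paths from the origin, of uniformly bounded cost
`∑ (ℓ n) ^ β`, leading to arbitrarily short cells. -/
lemma exists_bounded_paths (r : ℕ) (β : ℝ) (hβ0 : 0 < β) (hβ1 : β < 1) (hr : 2 ≤ r * β)
    (ℓ : (ℕ → ℕ) → ℝ) (hℓ : ∀ n, 0 ≤ ℓ n) (B : ℝ)
    (hB : ∀ s : Finset (ℕ → ℕ), (∀ n ∈ s, ∀ i, n i ≠ 0 → i < r + 1) → ∑ n ∈ s, ℓ n ≤ B) :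
    ∃ S : ℝ, ∀ Q : (ℕ → ℕ) → ℝ → Prop, Q 0 0 →
      (∀ n s i, i < r + 1 → Q n s → Q (n + Pi.single i 1) (s + ℓ n ^ β)) →
      ∀ δ > 0, ∃ n, ℓ n < δ ∧ ∃ s ≤ S, Q n s := by
  classical
  set c : ℕ → ℝ := fun t => (((Finset.range (r + 1)).piAntidiag t).card : ℝ) with hc
  have hc1 : ∀ t, 1 ≤ c t := by
    intro t
    simp only [hc, card_piAntidiag_range]
    exact_mod_cast Nat.choose_pos (by omega)
  have hcle : ∀ t, (c t) ^ (-β) ≤ (r.factorial : ℝ) ^ β * (((t + 1 : ℕ) : ℝ) ^ (2 : ℝ))⁻¹ := by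
    intro t
    have h1 : ((t + 1 : ℕ) : ℝ) ^ r / r.factorial ≤ c t := by
      have := Nat.pow_le_choose (α := ℝ) r (t + r)
      rw [show t + r + 1 - r = t + 1 by omega] at this
      simpa only [hc, card_piAntidiag_range] using this
    have hf : (0 : ℝ) < r.factorial := by exact_mod_cast r.factorial_pos
    have ht : (0 : ℝ) < ((t + 1 : ℕ) : ℝ) := by positivity
    have ht1 : (1 : ℝ) ≤ ((t + 1 : ℕ) : ℝ) := by exact_mod_cast Nat.succ_pos t
    calc (c t) ^ (-β) ≤ (((t + 1 : ℕ) : ℝ) ^ r / r.factorial) ^ (-β) :=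
          Real.rpow_le_rpow_of_nonpos (by positivity) h1 (by linarith)
      _ = (r.factorial : ℝ) ^ β * (((t + 1 : ℕ) : ℝ) ^ (r * β))⁻¹ := by
          rw [Real.rpow_neg (by positivity), Real.div_rpow (by positivity) hf.le,
            ← Real.rpow_natCast, ← Real.rpow_mul ht.le, inv_div, div_eq_mul_inv]
      _ ≤ _ := by
          gcongr
  have hyoung : ∀ t n, ℓ n ^ β / c t ≤ ℓ n + (c t) ^ (-β) / c t := by
    intro t n
    have hct : 0 < c t := lt_of_lt_of_le one_pos (hc1 t)
    have h1 := Real.geom_mean_le_arith_mean2_weighted hβ0.le (by linarith : 0 ≤ 1 - β) (hℓ n)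
      (by positivity : 0 ≤ (c t) ^ (-(1 - β)⁻¹)) (by ring)
    rw [← Real.rpow_mul hct.le, neg_mul, inv_mul_cancel₀ (by linarith : 1 - β ≠ 0),
      Real.rpow_neg_one, ← div_eq_mul_inv] at h1
    have h2 : (c t) ^ (-(1 - β)⁻¹) ≤ (c t) ^ (-β) / c t := by
      rw [div_eq_mul_inv, ← Real.rpow_neg_one (c t), ← Real.rpow_add hct]
      refine Real.rpow_le_rpow_of_exponent_le (hc1 t) ?_
      have : 1 + β ≤ (1 - β)⁻¹ := by
        rw [le_inv_comm₀ (by linarith) (by linarith), inv_eq_one_div, le_div_iff₀ (by linarith)]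
        nlinarith
      linarith
    have h3 : 0 ≤ (c t) ^ (-(1 - β)⁻¹) := by positivity
    nlinarith [hℓ n]
  have hsummable : Summable fun t : ℕ =>
      (r.factorial : ℝ) ^ β * (((t + 1 : ℕ) : ℝ) ^ (2 : ℝ))⁻¹ :=
    ((summable_nat_add_iff 1).2 (Real.summable_nat_rpow_inv.2 one_lt_two)).mul_left _
  set M : ℝ := ∑' t : ℕ, (r.factorial : ℝ) ^ β * (((t + 1 : ℕ) : ℝ) ^ (2 : ℝ))⁻¹
  have hdisj : ∀ s : Finset ℕ, (s : Set ℕ).PairwiseDisjoint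
      fun t => (Finset.range (r + 1)).piAntidiag t := by
    intro s a _ b _ hab
    refine Finset.disjoint_left.2 fun n ha hb => hab ?_
    rw [← (Finset.mem_piAntidiag.1 ha).1, (Finset.mem_piAntidiag.1 hb).1]
  have hsumt : ∀ t, ∑ s ∈ Finset.range t, (∑ n ∈ (Finset.range (r + 1)).piAntidiag s, ℓ n ^ β) /
      c s ≤ B + M := by
    intro t
    have h1 : ∀ s, (∑ n ∈ (Finset.range (r + 1)).piAntidiag s, ℓ n ^ β) / c s ≤
        (∑ n ∈ (Finset.range (r + 1)).piAntidiag s, ℓ n) +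
          (r.factorial : ℝ) ^ β * (((s + 1 : ℕ) : ℝ) ^ (2 : ℝ))⁻¹ := by
      intro s
      have hcs : c s ≠ 0 := (lt_of_lt_of_le one_pos (hc1 s)).ne'
      rw [Finset.sum_div]
      refine (Finset.sum_le_sum fun n _ => hyoung s n).trans ?_
      rw [Finset.sum_add_distrib, Finset.sum_const, nsmul_eq_mul]
      change _ + c s * _ ≤ _
      rw [mul_div_cancel₀ _ hcs]
      linarith [hcle s]
    refine (Finset.sum_le_sum fun s _ => h1 s).trans ?_
    rw [Finset.sum_add_distrib, ← Finset.sum_biUnion (hdisj _)]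
    refine add_le_add (hB _ ?_) (hsummable.sum_le_tsum _ fun i _ => by positivity)
    intro n hn i hi
    obtain ⟨s, _, hs⟩ := Finset.mem_biUnion.1 hn
    exact Finset.mem_range.1 ((Finset.mem_piAntidiag.1 hs).2 i hi)
  refine ⟨B + M, fun Q h0 hstep δ hδ => ?_⟩
  have hex : ∀ t, ∃ n ∈ (Finset.range (r + 1)).piAntidiag t, ∃ s ≤ B + M, Q n s := by
    intro t
    have hne : ((Finset.range (r + 1)).piAntidiag t).Nonempty := by
      rw [← Finset.card_pos, card_piAntidiag_range]
      exact Nat.choose_pos (by omega)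
    obtain ⟨n, hn, hle⟩ := Finset.exists_le_of_sum_le (f := averageCost (r + 1) (fun n => ℓ n ^ β) t)
      (g := fun _ => B + M) hne (by
        rw [sum_averageCost, Finset.sum_const, nsmul_eq_mul]
        exact mul_le_mul_of_nonneg_left (hsumt t) (by positivity))
    obtain ⟨s, hs, hQ⟩ := exists_le_averageCost _ _ Q h0 hstep t n hn
    exact ⟨n, hn, s, hs.trans hle, hQ⟩
  choose n hn hQ using hex
  have hinj : Function.Injective n := by
    intro a b hab
    rw [← (Finset.mem_piAntidiag.1 (hn a)).1, hab, (Finset.mem_piAntidiag.1 (hn b)).1]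
  by_contra! hcon
  have hall : ∀ t, δ ≤ ℓ (n t) := by
    intro t
    by_contra! hlt
    obtain ⟨s, hs, hq⟩ := hQ t
    exact hcon _ hlt s hs hq
  obtain ⟨T, hT⟩ := exists_nat_gt (B / δ)
  have h1 := hB ((Finset.range T).map ⟨n, hinj⟩) (by
    intro m hm i hi
    obtain ⟨t, _, rfl⟩ := Finset.mem_map.1 hm
    exact Finset.mem_range.1 ((Finset.mem_piAntidiag.1 (hn t)).2 i hi))
  rw [Finset.sum_map] at h1
  have h2 : ∑ t ∈ Finset.range T, δ ≤ ∑ t ∈ Finset.range T, ℓ (n t) :=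
    Finset.sum_le_sum fun t _ => hall t
  rw [Finset.sum_const, Finset.card_range, nsmul_eq_mul] at h2
  rw [div_lt_iff₀ hδ] at hT
  exact absurd (h2.trans h1) (not_le.2 hT)

/-- `S` is invariant under every element of `G`. -/
def InvariantUnder (G : Subgroup HomeoR) (S : Set ℝ) : Prop := ∀ g ∈ G, ∀ x ∈ S, g x ∈ S

lemma InvariantUnder.image_eq {G : Subgroup HomeoR} {S : Set ℝ} (hS : InvariantUnder G S)
    {g : HomeoR} (hg : g ∈ G) : ⇑g '' S = S := by
  refine Subset.antisymm (image_subset_iff.2 fun x hx => hS g hg x hx) fun x hx => ?_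
  exact ⟨g⁻¹ x, hS _ (inv_mem hg) x hx, RelIso.apply_inv_self g x⟩

lemma invariantUnder_of_image_eq {G : Subgroup HomeoR} {S : Set ℝ}
    (hS : ∀ g ∈ G, ⇑g '' S = S) : InvariantUnder G S :=
  fun g hg _ hx => (hS g hg).subset (mem_image_of_mem g hx)

lemma minimalSet_singleton {G : Subgroup HomeoR} {x : ℝ} (hx : ∀ g ∈ G, g x = x) :
    MinimalSet G {x} := by
  refine ⟨singleton_nonempty x, isClosed_singleton, fun g hg => by simp [hx g hg], ?_⟩
  intro S hS hne _ _
  exact (subset_singleton_iff_eq.1 hS).resolve_left hne.ne_empty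

lemma exists_le_pow_apply {f : HomeoR} (hf : ∀ x, x < f x) (y c : ℝ) :
    ∃ n : ℕ, c ≤ (f ^ n) y := by
  by_contra! hcon
  have hbdd : BddAbove (range fun n : ℕ => (f ^ n) y) :=
    ⟨c, by rintro _ ⟨n, rfl⟩; exact (hcon n).le⟩
  set L := sSup (range fun n : ℕ => (f ^ n) y)
  have hL : f⁻¹ L < L := by
    have := hf (f⁻¹ L)
    rwa [RelIso.apply_inv_self] at this
  obtain ⟨_, ⟨n, rfl⟩, hn⟩ := exists_lt_of_lt_csSup (range_nonempty _) hL
  have h1 : L < (f ^ (n + 1)) y := by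
    have := f.strictMono hn
    rwa [RelIso.apply_inv_self, ← RelIso.mul_apply, ← pow_succ'] at this
  exact absurd (le_csSup hbdd ⟨n + 1, rfl⟩) (not_le.2 h1)

lemma exists_mem_Icc_of_forall_lt {G : Subgroup HomeoR} {f : HomeoR} (hfG : f ∈ G)
    (hf : ∀ x, x < f x) {S : Set ℝ} (hS : InvariantUnder G S) (hne : S.Nonempty) :
    (Icc 0 (f 0) ∩ S).Nonempty := by
  classical
  obtain ⟨y, hy⟩ := hne
  have h1 := exists_le_pow_apply hf y 0
  have h2 := exists_le_pow_apply hf 0 y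
  rcases hn : Nat.find h1 with _ | n
  · have hy0 : 0 ≤ y := by simpa [hn] using Nat.find_spec h1
    rcases hm : Nat.find h2 with _ | m
    · have : y ≤ 0 := by simpa [hm] using Nat.find_spec h2
      obtain rfl : y = 0 := le_antisymm this hy0
      exact ⟨0, ⟨le_rfl, (hf 0).le⟩, hy⟩
    · have hlt : ¬ y ≤ (f ^ m) 0 := Nat.find_min h2 (by omega)
      have hle : y ≤ (f ^ (m + 1)) 0 := hm ▸ Nat.find_spec h2
      refine ⟨(f ^ m)⁻¹ y, ⟨?_, ?_⟩, hS _ (inv_mem (pow_mem hfG m)) y hy⟩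
      · rw [← (f ^ m).le_iff_le, RelIso.apply_inv_self]
        exact (not_le.1 hlt).le
      · rw [← (f ^ m).le_iff_le, RelIso.apply_inv_self, ← RelIso.mul_apply, ← pow_succ]
        exact hle
  · have hlt : ¬ 0 ≤ (f ^ n) y := Nat.find_min h1 (by omega)
    have hle : 0 ≤ (f ^ (n + 1)) y := hn ▸ Nat.find_spec h1
    refine ⟨(f ^ (n + 1)) y, ⟨hle, ?_⟩, hS _ (pow_mem hfG _) y hy⟩
    rw [pow_succ', RelIso.mul_apply]
    exact f.monotone (not_le.1 hlt).le

lemma exists_minimalSet_of_forall_lt {G : Subgroup HomeoR} {f : HomeoR} (hfG : f ∈ G)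
    (hf : ∀ x, x < f x) : ∃ Λ : Set ℝ, MinimalSet G Λ := by
  obtain ⟨Λ, -, hΛ⟩ := zorn_superset_nonempty
    {S : Set ℝ | S.Nonempty ∧ IsClosed S ∧ InvariantUnder G S} (by
      intro c hc hchain hcne
      refine ⟨⋂₀ c, ⟨?_, isClosed_sInter fun s hs => (hc hs).2.1,
        fun g hg x hx s hs => (hc hs).2.2 g hg x (hx s hs)⟩, fun s hs => sInter_subset_of_mem hs⟩
      have : Nonempty c := hcne.to_subtype
      have h := IsCompact.nonempty_iInter_of_directed_nonempty_isCompact_isClosed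
        (fun s : c => Icc 0 (f 0) ∩ (s : Set ℝ)) (by
          intro s t
          rcases hchain.total s.2 t.2 with h | h
          · exact ⟨s, Subset.rfl, inter_subset_inter_right _ h⟩
          · exact ⟨t, inter_subset_inter_right _ h, Subset.rfl⟩)
        (fun s => exists_mem_Icc_of_forall_lt hfG hf (hc s.2).2.2 (hc s.2).1)
        (fun s => isCompact_Icc.inter_right (hc s.2).2.1)
        (fun s => isClosed_Icc.inter (hc s.2).2.1)
      obtain ⟨x, hx⟩ := h
      exact ⟨x, fun s hs => (mem_iInter.1 hx ⟨s, hs⟩).2⟩)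
    univ ⟨univ_nonempty, isClosed_univ, fun _ _ _ _ => mem_univ _⟩
  refine ⟨Λ, hΛ.prop.1, hΛ.prop.2.1, fun g hg => hΛ.prop.2.2.image_eq hg, ?_⟩
  intro S hS hne hcl hinv
  exact hS.antisymm (hΛ.2 ⟨hne, hcl, invariantUnder_of_image_eq hinv⟩ hS)

lemma exists_minimalSet_of_free {G : Subgroup HomeoR} {f : HomeoR} (hfG : f ∈ G)
    (hf : ∀ x, f x ≠ x) : ∃ Λ : Set ℝ, MinimalSet G Λ := by
  by_cases h : ∀ x, x < f x
  · exact exists_minimalSet_of_forall_lt hfG h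
  push Not at h
  obtain ⟨y, hy⟩ := h
  refine exists_minimalSet_of_forall_lt (inv_mem hfG) fun x => ?_
  rw [← f.lt_iff_lt, RelIso.apply_inv_self]
  by_contra! hx
  obtain ⟨w, hw⟩ := mem_range_of_exists_le_of_exists_ge
    (f.continuous.sub continuous_id) ⟨y, sub_nonpos.2 hy⟩ ⟨x, sub_nonneg.2 hx⟩
  exact hf w (sub_eq_zero.1 hw)

lemma unbounded_of_no_global_fixed {G : Subgroup HomeoR} (hG : ∀ x, ∃ g ∈ G, g x ≠ x)
    {S : Set ℝ} (hne : S.Nonempty) (hcl : IsClosed S) (hS : InvariantUnder G S) :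
    ¬ BddAbove S ∧ ¬ BddBelow S := by
  constructor
  · intro hb
    obtain ⟨g, hg, hgx⟩ := hG (sSup S)
    have hm := hcl.csSup_mem hne hb
    refine hgx (le_antisymm (le_csSup hb (hS g hg _ hm)) ?_)
    have := g.monotone (le_csSup hb (hS _ (inv_mem hg) _ hm))
    rwa [RelIso.apply_inv_self] at this
  · intro hb
    obtain ⟨g, hg, hgx⟩ := hG (sInf S)
    have hm := hcl.csInf_mem hne hb
    refine hgx (le_antisymm ?_ (csInf_le hb (hS g hg _ hm)))
    have := g.monotone (csInf_le hb (hS _ (inv_mem hg) _ hm))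
    rwa [RelIso.apply_inv_self] at this

/-- The bounded interval `(p, q)` is a connected component of the complement of the closed
invariant set `S`. -/
structure IsGap (G : Subgroup HomeoR) (S : Set ℝ) (p q : ℝ) : Prop where
  closed : IsClosed S
  invariant : InvariantUnder G S
  lt : p < q
  left_mem : p ∈ S
  right_mem : q ∈ S
  not_mem : ∀ x ∈ S, p < x → q ≤ x

lemma exists_gap {G : Subgroup HomeoR} (hG : ∀ x, ∃ g ∈ G, g x ≠ x) {S : Set ℝ}
    (hne : S.Nonempty) (hcl : IsClosed S) (hS : InvariantUnder G S) {x y : ℝ} (hxy : x ≤ y)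
    (h : ∀ z ∈ S, x < z → y ≤ z) (hlt : x < y ∨ x ∉ S) :
    ∃ p q, IsGap G S p q ∧ p ≤ x ∧ y ≤ q := by
  obtain ⟨hua, hub⟩ := unbounded_of_no_global_fixed hG hne hcl hS
  obtain ⟨u, hu, hux⟩ : ∃ u ∈ S, u < x := by
    by_contra! hcon
    exact hub ⟨x, hcon⟩
  obtain ⟨v, hv, hyv⟩ : ∃ v ∈ S, y < v := by
    by_contra! hcon
    exact hua ⟨y, hcon⟩
  have hA : (S ∩ Iic x).Nonempty := ⟨u, hu, hux.le⟩
  have hB : (S ∩ Ici y).Nonempty := ⟨v, hv, hyv.le⟩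
  have hAb : BddAbove (S ∩ Iic x) := ⟨x, fun _ hz => hz.2⟩
  have hBb : BddBelow (S ∩ Ici y) := ⟨y, fun _ hz => hz.2⟩
  have hp := (hcl.inter isClosed_Iic).csSup_mem hA hAb
  have hq := (hcl.inter isClosed_Ici).csInf_mem hB hBb
  refine ⟨_, _, ⟨hcl, hS, ?_, hp.1, hq.1, fun z hz hpz => ?_⟩, hp.2, hq.2⟩
  · rcases hlt with hlt | hxS
    · exact (hp.2.trans_lt hlt).trans_le hq.2
    · exact (lt_of_le_of_ne hp.2 fun e => hxS (by rw [← e]; exact hp.1)).trans_le (hxy.trans hq.2)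
  · refine csInf_le hBb ⟨hz, h z hz (not_le.1 fun hzx => ?_)⟩
    exact absurd (le_csSup hAb ⟨hz, hzx⟩) (not_le.2 hpz)

lemma exists_larger_gap {G : Subgroup HomeoR} (hG : ∀ x, ∃ g ∈ G, g x ≠ x)
    {F : Set ℝ} {A : Set HomeoR} (hA : A ⊆ G) (hAinv : ∀ f ∈ A, f⁻¹ ∈ A)
    (hcomm : ∀ f ∈ A, ∀ g ∈ G, ∀ x ∈ F, f (g x) = g (f x))
    (hmove : ∀ x ∈ F, ∃ f ∈ A, f x ≠ x) (hfix : ∀ f ∈ A, ∃ x, f x = x)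
    {S : Set ℝ} (hSF : S ⊆ F) {p q : ℝ} (h : IsGap G S p q) :
    ∃ f ∈ A, ∃ S' ⊆ F, ∃ p' q', IsGap G S' p' q' ∧ p' ≤ p ∧ q ≤ q' ∧ f p' = p' ∧ f q' = q' ∧
      q ≤ f p := by
  obtain ⟨f, hf, hfp⟩ : ∃ f ∈ A, p < f p := by
    obtain ⟨f, hf, hfp⟩ := hmove p (hSF h.left_mem)
    rcases lt_or_gt_of_ne hfp with hlt | hlt
    · refine ⟨f⁻¹, hAinv f hf, ?_⟩
      rwa [← f.lt_iff_lt, RelIso.apply_inv_self]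
    · exact ⟨f, hf, hlt⟩
  have hfG := hA hf
  have hcl : IsClosed (S ∩ {x | f x = x}) :=
    h.closed.inter (isClosed_eq f.continuous continuous_id)
  have hinv : InvariantUnder G (S ∩ {x | f x = x}) := by
    intro g hg x hx
    refine ⟨h.invariant g hg x hx.1, ?_⟩
    change f (g x) = g x
    rw [hcomm f hf g hg x (hSF hx.1), hx.2]
  have hne : (S ∩ {x | f x = x}).Nonempty := by
    obtain ⟨y, hy⟩ := hfix f hf
    obtain ⟨-, hub⟩ := unbounded_of_no_global_fixed hG ⟨p, h.left_mem⟩ h.closed h.invariant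
    have hne : (S ∩ Iic y).Nonempty := by
      by_contra hcon
      exact hub ⟨y, fun z hz => not_lt.1 fun hzy => hcon ⟨z, hz, hzy.le⟩⟩
    have hb : BddAbove (S ∩ Iic y) := ⟨y, fun _ hz => hz.2⟩
    have hm := (h.closed.inter isClosed_Iic).csSup_mem hne hb
    have key : ∀ g ∈ G, g y = y → g (sSup (S ∩ Iic y)) ≤ sSup (S ∩ Iic y) := fun g hg hgy =>
      le_csSup hb ⟨h.invariant g hg _ hm.1, (g.monotone hm.2).trans_eq hgy⟩
    refine ⟨_, hm.1, le_antisymm (key f hfG hy) ?_⟩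
    have := f.monotone (key f⁻¹ (inv_mem hfG) (by
      conv_lhs => rw [← hy]
      exact RelIso.inv_apply_self f y))
    rwa [RelIso.apply_inv_self] at this
  obtain ⟨p', q', hgap, hp, hq⟩ := exists_gap hG hne hcl hinv h.lt.le
    (fun z hz => h.not_mem z hz.1) (.inl h.lt)
  exact ⟨f, hf, _, inter_subset_left.trans hSF, p', q', hgap, hp, hq, hgap.left_mem.2,
    hgap.right_mem.2, h.not_mem _ (h.invariant f hfG p h.left_mem) hfp⟩

/-- A sequence of nested intervals `[p j, q j]` and of homeomorphisms `f j` such that `f j`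
fixes the ends of the interval `[p (j + 1), q (j + 1)]` and moves `[p j, q j]` off itself. -/
structure IsTower (f : ℕ → HomeoR) (p q : ℕ → ℝ) : Prop where
  lt : p 0 < q 0
  left_le : ∀ j, p (j + 1) ≤ p j
  le_right : ∀ j, q j ≤ q (j + 1)
  fix_left : ∀ j, f j (p (j + 1)) = p (j + 1)
  fix_right : ∀ j, f j (q (j + 1)) = q (j + 1)
  move : ∀ j, q j ≤ f j (p j)

lemma exists_tower {G : Subgroup HomeoR} (hG : ∀ x, ∃ g ∈ G, g x ≠ x)
    {F : Set ℝ} {A : Set HomeoR} (hA : A ⊆ G) (hAinv : ∀ f ∈ A, f⁻¹ ∈ A)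
    (hcomm : ∀ f ∈ A, ∀ g ∈ G, ∀ x ∈ F, f (g x) = g (f x))
    (hmove : ∀ x ∈ F, ∃ f ∈ A, f x ≠ x) (hfix : ∀ f ∈ A, ∃ x, f x = x)
    {a b : ℝ} (h : IsGap G F a b) :
    ∃ f p q, IsTower f p q ∧ (∀ j, f j ∈ A) ∧ p 0 = a ∧ q 0 = b := by
  let State := {s : Set ℝ × ℝ × ℝ // s.1 ⊆ F ∧ IsGap G s.1 s.2.1 s.2.2}
  have hstep : ∀ s : State, ∃ f ∈ A, ∃ s' : State, s'.1.2.1 ≤ s.1.2.1 ∧ s.1.2.2 ≤ s'.1.2.2 ∧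
      f s'.1.2.1 = s'.1.2.1 ∧ f s'.1.2.2 = s'.1.2.2 ∧ s.1.2.2 ≤ f s.1.2.1 := by
    rintro ⟨⟨S, p, q⟩, hS, hgap⟩
    obtain ⟨f, hf, S', hS', p', q', hgap', h1⟩ :=
      exists_larger_gap hG hA hAinv hcomm hmove hfix hS hgap
    exact ⟨f, hf, ⟨⟨S', p', q'⟩, hS', hgap'⟩, h1⟩
  choose φ hφ next hnext using hstep
  let s : ℕ → State := fun j => Nat.rec ⟨⟨F, a, b⟩, Subset.rfl, h⟩ (fun _ => next) j
  refine ⟨fun j => φ (s j), fun j => (s j).1.2.1, fun j => (s j).1.2.2, ⟨h.lt, ?_, ?_, ?_, ?_, ?_⟩,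
    fun j => hφ _, rfl, rfl⟩ <;> intro j
  · exact (hnext (s j)).1
  · exact (hnext (s j)).2.1
  · exact (hnext (s j)).2.2.1
  · exact (hnext (s j)).2.2.2.1
  · exact (hnext (s j)).2.2.2.2

/-- The composition `f (j - 1) ^ n (j - 1) ∘ ⋯ ∘ f 0 ^ n 0`. -/
def latticeMap (f : ℕ → HomeoR) (n : ℕ → ℕ) : ℕ → HomeoR
  | 0 => 1
  | j + 1 => f j ^ n j * latticeMap f n j

lemma pow_apply_of_fixed {f : HomeoR} {x : ℝ} (h : f x = x) (m : ℕ) : (f ^ m) x = x := by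
  induction m with
  | zero => rfl
  | succ m ih => rw [pow_succ', RelIso.mul_apply, ih, h]

lemma latticeMap_zero (f : ℕ → HomeoR) (k : ℕ) : latticeMap f 0 k = 1 := by
  induction k with
  | zero => rfl
  | succ k ih => simp [latticeMap, ih]

namespace IsTower

variable {f : ℕ → HomeoR} {p q : ℕ → ℝ}

lemma latticeMap_mem (h : IsTower f p q) (n : ℕ → ℕ) {x : ℝ} (hx : x ∈ Icc (p 0) (q 0)) (j : ℕ) :
    latticeMap f n j x ∈ Icc (p j) (q j) := by
  induction j with
  | zero => exact hx
  | succ j ih =>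
    have h1 := (f j ^ n j).monotone ((h.left_le j).trans ih.1)
    have h2 := (f j ^ n j).monotone (ih.2.trans (h.le_right j))
    rw [pow_apply_of_fixed (h.fix_left j)] at h1
    rw [pow_apply_of_fixed (h.fix_right j)] at h2
    exact ⟨h1, h2⟩

lemma left_le_right (h : IsTower f p q) (j : ℕ) : p j ≤ q j := by
  have := h.latticeMap_mem 0 (left_mem_Icc.2 h.lt.le) j
  exact this.1.trans this.2

lemma right_le_pow (h : IsTower f p q) (j d : ℕ) : q j ≤ (f j ^ (d + 1)) (p j) := by
  induction d with
  | zero => simpa using h.move j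
  | succ d ih =>
    rw [pow_succ', RelIso.mul_apply]
    exact (h.move j).trans ((f j).monotone ((h.left_le_right j).trans ih))

lemma latticeMap_lt_aux (h : IsTower f p q) {n m : ℕ → ℕ} {j : ℕ} (hlt : n j < m j) :
    latticeMap f n (j + 1) (q 0) ≤ latticeMap f m (j + 1) (p 0) := by
  obtain ⟨d, hd⟩ := Nat.exists_eq_add_of_lt hlt
  have h1 := (h.latticeMap_mem n (right_mem_Icc.2 h.lt.le) j).2
  have h2 := (h.latticeMap_mem m (left_mem_Icc.2 h.lt.le) j).1
  have h3 := (h.right_le_pow j d).trans ((f j ^ (d + 1)).monotone h2)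
  have h4 := (f j ^ n j).monotone (h1.trans h3)
  rw [← RelIso.mul_apply _ (f j ^ (d + 1)), ← pow_add, ← add_assoc, ← hd] at h4
  exact h4

lemma latticeMap_disjoint (h : IsTower f p q) {n m : ℕ → ℕ} (j : ℕ) (hne : ∃ i < j, n i ≠ m i) :
    latticeMap f n j (q 0) ≤ latticeMap f m j (p 0) ∨
      latticeMap f m j (q 0) ≤ latticeMap f n j (p 0) := by
  induction j with
  | zero => obtain ⟨i, hi, _⟩ := hne; omega
  | succ j ih =>
    rcases lt_trichotomy (n j) (m j) with hlt | heq | hlt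
    · exact .inl (h.latticeMap_lt_aux hlt)
    · obtain ⟨i, hi, hni⟩ := hne
      have hij : i < j := by
        rcases Nat.lt_succ_iff_lt_or_eq.1 hi with hij | rfl
        · exact hij
        · exact absurd heq hni
      simp only [latticeMap, RelIso.mul_apply, heq]
      exact (ih ⟨i, hij, hni⟩).imp (fun e => (f j ^ m j).monotone e)
        fun e => (f j ^ m j).monotone e
    · exact .inr (h.latticeMap_lt_aux hlt)

lemma sum_length_le (h : IsTower f p q) (k : ℕ) (s : Finset (ℕ → ℕ))
    (hs : ∀ n ∈ s, ∀ i, n i ≠ 0 → i < k) :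
    ∑ n ∈ s, (latticeMap f n k (q 0) - latticeMap f n k (p 0)) ≤ q k - p k := by
  have hdisj : (s : Set (ℕ → ℕ)).PairwiseDisjoint
      fun n => Ioc (latticeMap f n k (p 0)) (latticeMap f n k (q 0)) := by
    intro n hn m hm hnm
    have hne : ∃ i < k, n i ≠ m i := by
      by_contra! hcon
      refine hnm (funext fun i => ?_)
      by_cases hi : i < k
      · exact hcon i hi
      · rw [not_imp_comm.1 (hs n hn i) hi, not_imp_comm.1 (hs m hm i) hi]
    refine Set.disjoint_left.2 fun x hx hy => ?_
    rcases h.latticeMap_disjoint k hne with h1 | h1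
    · exact absurd (hx.2.trans h1) (not_le.2 hy.1)
    · exact absurd (hy.2.trans h1) (not_le.2 hx.1)
  have hsub : (⋃ n ∈ s, Ioc (latticeMap f n k (p 0)) (latticeMap f n k (q 0))) ⊆
      Icc (p k) (q k) := by
    refine iUnion₂_subset fun n _ x hx => ?_
    exact ⟨(h.latticeMap_mem n (left_mem_Icc.2 h.lt.le) k).1.trans hx.1.le,
      hx.2.trans (h.latticeMap_mem n (right_mem_Icc.2 h.lt.le) k).2⟩
  have hm := measure_mono (μ := volume) hsub
  rw [measure_biUnion_finset hdisj fun _ _ => measurableSet_Ioc] at hm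
  simp only [Real.volume_Ioc, Real.volume_Icc] at hm
  rw [← ENNReal.ofReal_sum_of_nonneg fun n _ =>
    sub_nonneg.2 ((latticeMap f n k).monotone h.lt.le)] at hm
  exact (ENNReal.ofReal_le_ofReal_iff (sub_nonneg.2 (h.left_le_right k))).1 hm

end IsTower

lemma latticeMap_add_single {G : Subgroup HomeoR} {F : Set ℝ} (hF : InvariantUnder G F)
    {f : ℕ → HomeoR} (hf : ∀ j, f j ∈ G)
    (hcomm : ∀ i j, ∀ x ∈ F, f i (f j x) = f j (f i x)) (n : ℕ → ℕ) (i : ℕ) {x : ℝ}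
    (hx : x ∈ F) (k : ℕ) (hi : i < k) :
    latticeMap f (n + Pi.single i 1) k x = f i (latticeMap f n k x) := by
  have hpow : ∀ j m, ∀ y ∈ F, (f j ^ m) (f i y) = f i ((f j ^ m) y) := by
    intro j m y hy
    induction m with
    | zero => rfl
    | succ m ih =>
      rw [pow_succ', RelIso.mul_apply, RelIso.mul_apply, ih,
        hcomm j i _ (hF _ (pow_mem (hf j) m) y hy)]
  have hmem : ∀ j, latticeMap f n j ∈ G := by
    intro j
    induction j with
    | zero => exact one_mem G
    | succ j ih => exact mul_mem (pow_mem (hf j) _) ih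
  have hlow : ∀ j ≤ i, latticeMap f (n + Pi.single i 1) j = latticeMap f n j := by
    intro j hj
    induction j with
    | zero => rfl
    | succ j ih =>
      have hji : j ≠ i := by omega
      simp [latticeMap, ih (by omega), hji]
  induction k with
  | zero => omega
  | succ k ih =>
    simp only [latticeMap, RelIso.mul_apply]
    by_cases hik : i = k
    · subst hik
      rw [hlow i le_rfl]
      simp [pow_succ', RelIso.mul_apply]
    · have hki : k ≠ i := Ne.symm hik
      rw [ih (by omega), ← hpow k _ _ (hF _ (hmem k) x hx)]
      simp [hki]

/-- `g` is a `C¹` diffeomorphism whose derivative is locally `α`-Hölder. -/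
def IsHolderDiffeo (α : ℝ≥0) (g : HomeoR) : Prop :=
  ContDiff ℝ 1 (⇑g) ∧ (∀ x : ℝ, deriv (⇑g) x ≠ 0) ∧
    ∀ K : Set ℝ, IsCompact K → ∃ C : ℝ≥0, HolderOnWith C α (deriv (⇑g)) K

namespace IsHolderDiffeo

variable {α : ℝ≥0} {g : HomeoR}

lemma differentiable (hg : IsHolderDiffeo α g) : Differentiable ℝ g :=
  hg.1.differentiable one_ne_zero

lemma continuous_deriv (hg : IsHolderDiffeo α g) : Continuous (deriv g) :=
  hg.1.continuous_deriv le_rfl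

lemma deriv_pos (hg : IsHolderDiffeo α g) (x : ℝ) : 0 < deriv g x :=
  lt_of_le_of_ne g.monotone.deriv_nonneg (hg.2.1 x).symm

lemma deriv_mul {h : HomeoR} (hg : IsHolderDiffeo α g) (hh : IsHolderDiffeo α h) (x : ℝ) :
    deriv (g * h) x = deriv g (h x) * deriv h x :=
  deriv_comp x (hg.differentiable _) (hh.differentiable x)

lemma log_deriv_holder (hg : IsHolderDiffeo α g) {β : ℝ≥0} (hβ : β ≤ α) (u v : ℝ) :
    ∃ C : ℝ, 0 ≤ C ∧ ∀ x ∈ Icc u v, ∀ y ∈ Icc u v,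
      Real.log (deriv g x) - Real.log (deriv g y) ≤ C * |x - y| ^ (β : ℝ) := by
  rcases (Icc u v).eq_empty_or_nonempty with he | hne
  · exact ⟨0, le_rfl, by simp [he]⟩
  obtain ⟨C, hC⟩ := HolderOnWith.exists_holderOnWith_of_le (hg.2.2 _ isCompact_Icc) hβ
    (Metric.isBounded_Icc u v)
  obtain ⟨w, -, hw⟩ := isCompact_Icc.exists_isMinOn hne hg.continuous_deriv.continuousOn
  have hwp := hg.deriv_pos w
  refine ⟨C / deriv g w, by positivity, fun x hx y hy => ?_⟩
  have hxp := hg.deriv_pos x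
  have hyp := hg.deriv_pos y
  have hd := hC.dist_le hx hy
  rw [Real.dist_eq, Real.dist_eq] at hd
  rw [← Real.log_div hxp.ne' hyp.ne']
  calc Real.log (deriv g x / deriv g y) ≤ deriv g x / deriv g y - 1 :=
        Real.log_le_sub_one_of_pos (by positivity)
    _ = (deriv g x - deriv g y) / deriv g y := by field_simp
    _ ≤ (C * |x - y| ^ (β : ℝ)) / deriv g y := by
        gcongr
        exact (le_abs_self _).trans hd
    _ ≤ (C * |x - y| ^ (β : ℝ)) / deriv g w := by
        gcongr
        exact hw hy
    _ = C / deriv g w * |x - y| ^ (β : ℝ) := by ring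

end IsHolderDiffeo

/-- Along suitable compositions of the maps of a tower, the distortion on the innermost interval
stays bounded while its images become arbitrarily short. -/
lemma IsTower.exists_bounded_distortion {α : ℝ≥0} (hα : 0 < α) {G : Subgroup HomeoR}
    (hsmooth : ∀ g ∈ G, IsHolderDiffeo α g) {F : Set ℝ} (hF : InvariantUnder G F)
    {f : ℕ → HomeoR} {p q : ℕ → ℝ} (h : IsTower f p q) (hf : ∀ j, f j ∈ G)
    (hcomm : ∀ i j, ∀ x ∈ F, f i (f j x) = f j (f i x)) (hp : p 0 ∈ F) (hq : q 0 ∈ F) :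
    ∃ u v D : ℝ, ∀ δ > 0, ∃ w ∈ G, u ≤ w (p 0) ∧ w (q 0) ≤ v ∧ w (q 0) - w (p 0) < δ ∧
      ∀ x ∈ Icc (p 0) (q 0), ∀ y ∈ Icc (p 0) (q 0),
        Real.log (deriv w x) - Real.log (deriv w y) ≤ D := by
  set β : ℝ≥0 := min α (1 / 2) with hβ
  have hβ0 : 0 < β := lt_min hα (by norm_num)
  have hβ0' : (0 : ℝ) < β := by exact_mod_cast hβ0
  have hβ1 : (β : ℝ) < 1 := by
    have : β < 1 := (min_le_right _ _).trans_lt (NNReal.half_lt_self one_ne_zero)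
    exact_mod_cast this
  set r : ℕ := ⌈2 / (β : ℝ)⌉₊
  have hr : 2 ≤ (r : ℝ) * β := (div_le_iff₀ hβ0').1 (Nat.le_ceil _)
  choose c hc0 hc using fun j =>
    (hsmooth _ (hf j)).log_deriv_holder (min_le_left α (1 / 2)) (p (r + 1)) (q (r + 1))
  rw [← hβ] at hc
  set C : ℝ := ∑ j ∈ Finset.range (r + 1), c j
  have hC0 : 0 ≤ C := Finset.sum_nonneg fun j _ => hc0 j
  have hcC : ∀ i < r + 1, c i ≤ C := fun i hi =>
    Finset.single_le_sum (f := c) (fun j _ => hc0 j) (Finset.mem_range.2 hi)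
  obtain ⟨S, hS⟩ := exists_bounded_paths r β hβ0' hβ1 hr
    (fun n => latticeMap f n (r + 1) (q 0) - latticeMap f n (r + 1) (p 0))
    (fun n => sub_nonneg.2 ((latticeMap f n (r + 1)).monotone h.lt.le)) _
    (h.sum_length_le (r + 1))
  have hpath := hS (fun n s => ∃ w ∈ G, w (p 0) = latticeMap f n (r + 1) (p 0) ∧
    w (q 0) = latticeMap f n (r + 1) (q 0) ∧
    ∀ x ∈ Icc (p 0) (q 0), ∀ y ∈ Icc (p 0) (q 0),
      Real.log (deriv w x) - Real.log (deriv w y) ≤ C * s)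
    ⟨1, one_mem G, by rw [latticeMap_zero], by rw [latticeMap_zero], fun x _ y _ => by simp⟩
    (by
      rintro n s i hi ⟨w, hw, hwp, hwq, hdist⟩
      refine ⟨f i * w, mul_mem (hf i) hw, ?_, ?_, fun x hx y hy => ?_⟩
      · rw [latticeMap_add_single hF hf hcomm n i hp _ hi, RelIso.mul_apply, hwp]
      · rw [latticeMap_add_single hF hf hcomm n i hq _ hi, RelIso.mul_apply, hwq]
      · have hmem : ∀ x ∈ Icc (p 0) (q 0), w x ∈ Icc (p (r + 1)) (q (r + 1)) := fun x hx =>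
          ⟨(h.latticeMap_mem n (left_mem_Icc.2 h.lt.le) _).1.trans
            (hwp.symm.le.trans (w.monotone hx.1)),
          ((w.monotone hx.2).trans hwq.le).trans
            (h.latticeMap_mem n (right_mem_Icc.2 h.lt.le) _).2⟩
        have hfi := hsmooth _ (hf i)
        have hw' := hsmooth _ hw
        rw [hfi.deriv_mul hw', hfi.deriv_mul hw',
          Real.log_mul (hfi.deriv_pos _).ne' (hw'.deriv_pos _).ne',
          Real.log_mul (hfi.deriv_pos _).ne' (hw'.deriv_pos _).ne']
        have hle : |w x - w y| ≤
            latticeMap f n (r + 1) (q 0) - latticeMap f n (r + 1) (p 0) := by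
          rw [← hwp, ← hwq]
          have h1 := w.monotone hx.1
          have h2 := w.monotone hx.2
          have h3 := w.monotone hy.1
          have h4 := w.monotone hy.2
          exact abs_sub_le_iff.2 ⟨by linarith, by linarith⟩
        have h5 := hc i _ (hmem x hx) _ (hmem y hy)
        have h6 : c i * |w x - w y| ^ (β : ℝ) ≤ C *
            (latticeMap f n (r + 1) (q 0) - latticeMap f n (r + 1) (p 0)) ^ (β : ℝ) :=
          mul_le_mul (hcC i hi) (Real.rpow_le_rpow (abs_nonneg _) hle hβ0'.le)
            (by positivity) hC0
        have h7 := hdist x hx y hy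
        rw [mul_add]
        linarith)
  refine ⟨p (r + 1), q (r + 1), C * S, fun δ hδ => ?_⟩
  obtain ⟨n, hn, s, hs, w, hw, hwp, hwq, hdist⟩ := hpath δ hδ
  refine ⟨w, hw, ?_, ?_, by rw [hwp, hwq]; exact hn, fun x hx y hy =>
    (hdist x hx y hy).trans (mul_le_mul_of_nonneg_left hs hC0)⟩
  · exact hwp ▸ (h.latticeMap_mem n (left_mem_Icc.2 h.lt.le) _).1
  · exact hwq ▸ (h.latticeMap_mem n (right_mem_Icc.2 h.lt.le) _).2

/-- A Kopell-type lemma: if the images of `[a, b]` under elements of `G` get arbitrarily short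
inside a compact set with bounded distortion, then a central element of `G` fixing the ends of
all these images does not move points of `[a, b]` to the right. -/
lemma apply_le_of_bounded_distortion {α : ℝ≥0} {G : Subgroup HomeoR}
    (hsmooth : ∀ g ∈ G, IsHolderDiffeo α g) {a b u v D : ℝ} (hab : a < b)
    (hD : ∀ δ > 0, ∃ w ∈ G, u ≤ w a ∧ w b ≤ v ∧ w b - w a < δ ∧
      ∀ x ∈ Icc a b, ∀ y ∈ Icc a b, Real.log (deriv w x) - Real.log (deriv w y) ≤ D)
    {z : HomeoR} (hz : z ∈ G) (hcomm : ∀ g ∈ G, Commute z g) (hza : z a = a) (hzb : z b = b)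
    {x₀ : ℝ} (hx₀ : x₀ ∈ Icc a b) : z x₀ ≤ x₀ := by
  by_contra! hlt
  set κ : ℝ := (2 * Real.exp D)⁻¹
  have hκ : 0 < κ := by positivity
  have hpow : ∀ m : ℕ, ∀ x ∈ Icc a b, (z ^ m) x ∈ Icc a b := by
    intro m x hx
    have h1 := (z ^ m).monotone hx.1
    have h2 := (z ^ m).monotone hx.2
    rw [pow_apply_of_fixed hza] at h1
    rw [pow_apply_of_fixed hzb] at h2
    exact ⟨h1, h2⟩
  have hderiv : ∀ m : ℕ, ∀ x ∈ Icc a b, κ ≤ deriv (⇑(z ^ m)) x := by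
    intro m x hx
    have hzm := hsmooth _ (pow_mem hz m)
    obtain ⟨δ, hδ, hunif⟩ := Metric.uniformContinuousOn_iff.1
      (isCompact_Icc.uniformContinuousOn_of_continuous (s := Icc u v)
        hzm.continuous_deriv.continuousOn) (1 / 2) (by norm_num)
    obtain ⟨w, hw, huw, hwv, hshort, hdist⟩ := hD δ hδ
    have hw' := hsmooth _ hw
    have hc : z ^ m * w = w * z ^ m := (hcomm w hw).pow_left m
    have hfix : ∀ y, z y = y → (z ^ m) (w y) = w y := by
      intro y hy
      rw [← RelIso.mul_apply, hc, RelIso.mul_apply, pow_apply_of_fixed hy]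
    have hwab : w a < w b := w.strictMono hab
    obtain ⟨y, hy, hy1⟩ := exists_deriv_eq_slope (⇑(z ^ m)) hwab
      hzm.differentiable.continuous.continuousOn hzm.differentiable.differentiableOn
    rw [hfix a hza, hfix b hzb, div_self (sub_pos.2 hwab).ne'] at hy1
    have hwx : w x ∈ Icc (w a) (w b) := ⟨w.monotone hx.1, w.monotone hx.2⟩
    have hclose := hunif (w x) ⟨huw.trans hwx.1, hwx.2.trans hwv⟩ y
      ⟨huw.trans hy.1.le, hy.2.le.trans hwv⟩ (by
        rw [Real.dist_eq]
        exact abs_sub_lt_iff.2 ⟨by linarith [hwx.2, hy.1], by linarith [hwx.1, hy.2]⟩)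
    rw [hy1, Real.dist_eq] at hclose
    have hhalf : 1 / 2 ≤ deriv (⇑(z ^ m)) (w x) := by linarith [(abs_lt.1 hclose).1]
    have heq : deriv (⇑(z ^ m)) (w x) * deriv w x =
        deriv w ((z ^ m) x) * deriv (⇑(z ^ m)) x := by
      rw [← hzm.deriv_mul hw', ← hw'.deriv_mul hzm, hc]
    have hratio : deriv w ((z ^ m) x) ≤ Real.exp D * deriv w x := by
      have := hdist _ (hpow m x hx) x hx
      rw [← Real.log_div (hw'.deriv_pos _).ne' (hw'.deriv_pos _).ne',
        Real.log_le_iff_le_exp (div_pos (hw'.deriv_pos _) (hw'.deriv_pos _)),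
        div_le_iff₀ (hw'.deriv_pos _)] at this
      exact this
    have hwp := hw'.deriv_pos x
    have hzp := hzm.deriv_pos x
    have h1 : 1 / 2 * deriv w x ≤ Real.exp D * deriv (⇑(z ^ m)) x * deriv w x := by
      calc 1 / 2 * deriv w x ≤ deriv (⇑(z ^ m)) (w x) * deriv w x := by gcongr
        _ = deriv w ((z ^ m) x) * deriv (⇑(z ^ m)) x := heq
        _ ≤ Real.exp D * deriv w x * deriv (⇑(z ^ m)) x := by gcongr
        _ = _ := by ring
    have h2 := le_of_mul_le_mul_right h1 hwp
    rw [inv_le_iff_one_le_mul₀ (by positivity)]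
    linarith
  have hzx : z x₀ ∈ Icc a b := by simpa using hpow 1 x₀ hx₀
  have hgrow : ∀ m : ℕ, x₀ + m * (κ * (z x₀ - x₀)) ≤ (z ^ m) x₀ := by
    intro m
    induction m with
    | zero => simp
    | succ m ih =>
      have hzm := hsmooth _ (pow_mem hz m)
      obtain ⟨y, hy, hy1⟩ := exists_deriv_eq_slope (⇑(z ^ m)) hlt
        hzm.differentiable.continuous.continuousOn hzm.differentiable.differentiableOn
      have hk := hderiv m y ⟨hx₀.1.trans hy.1.le, hy.2.le.trans hzx.2⟩
      rw [hy1, le_div_iff₀ (sub_pos.2 hlt)] at hk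
      rw [pow_succ, RelIso.mul_apply]
      push_cast
      linarith
  have hε : 0 < κ * (z x₀ - x₀) := mul_pos hκ (sub_pos.2 hlt)
  obtain ⟨m, hm⟩ := exists_nat_gt ((b - x₀) / (κ * (z x₀ - x₀)))
  rw [div_lt_iff₀ hε] at hm
  linarith [hgrow m, (hpow m x₀ hx₀).2]

lemma exists_ne_one_mem_center {G : Type*} [Group G] [Nontrivial G] [Group.IsNilpotent G] :
    ∃ z ∈ Subgroup.center G, z ≠ 1 := by
  classical
  have hex : ∃ n, Subgroup.upperCentralSeries G n ≠ ⊥ := by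
    obtain ⟨n, hn⟩ := Group.IsNilpotent.nilpotent G
    exact ⟨n, hn ▸ top_ne_bot⟩
  rcases hn : Nat.find hex with _ | n
  · exact absurd (Subgroup.upperCentralSeries_zero G) (hn ▸ Nat.find_spec hex)
  · have h1 : Subgroup.upperCentralSeries G n = ⊥ := not_not.1 (Nat.find_min hex (by omega))
    have h2 : Subgroup.upperCentralSeries G (n + 1) ≠ ⊥ := hn ▸ Nat.find_spec hex
    obtain ⟨z, hz, hz1⟩ := Subgroup.ne_bot_iff_exists_ne_one.1 h2 |>.imp fun z hz =>
      And.intro z.2 fun e => hz (Subtype.ext e)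
    refine ⟨z, Subgroup.mem_center_iff.2 fun g => ?_, hz1⟩
    have := Subgroup.mem_upperCentralSeries_succ_iff.1 hz g
    rw [h1, Subgroup.mem_bot, commutatorElement_eq_one_iff_mul_comm] at this
    exact this.symm

/-- The common fixed points of `z` and of the `i`-th term of the upper central series of `G`. -/
def centralFixSet (G : Subgroup HomeoR) (z : HomeoR) (i : ℕ) : Set ℝ :=
  {x | z x = x ∧ ∀ g ∈ Subgroup.upperCentralSeries G i, (g : HomeoR) x = x}

lemma isClosed_centralFixSet (G : Subgroup HomeoR) (z : HomeoR) (i : ℕ) :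
    IsClosed (centralFixSet G z i) := by
  have h : centralFixSet G z i =
      {x | z x = x} ∩ ⋂ g ∈ Subgroup.upperCentralSeries G i, {x | (g : HomeoR) x = x} := by
    ext x
    simp [centralFixSet]
  rw [h]
  exact (isClosed_eq z.continuous continuous_id).inter (isClosed_biInter fun g _ =>
    isClosed_eq (g : HomeoR).continuous continuous_id)

lemma invariantUnder_centralFixSet {G : Subgroup HomeoR} {z : HomeoR}
    (hz : ∀ g ∈ G, Commute z g) (i : ℕ) : InvariantUnder G (centralFixSet G z i) := by
  rintro g hg x ⟨hzx, hx⟩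
  refine ⟨?_, fun k hk => ?_⟩
  · rw [← RelIso.mul_apply, (hz g hg).eq, RelIso.mul_apply, hzx]
  · have hN : (Subgroup.upperCentralSeries G i).Normal := inferInstance
    have h1 := hx _ (hN.conj_mem k hk ⟨g, hg⟩⁻¹)
    have h2 : (k : HomeoR) * g = g * ((⟨g, hg⟩⁻¹ * k * ⟨g, hg⟩⁻¹⁻¹ : G) : HomeoR) := by
      push_cast
      group
    rw [← RelIso.mul_apply, h2, RelIso.mul_apply, h1]

lemma commute_on_centralFixSet {G : Subgroup HomeoR} {z : HomeoR}
    (hz : ∀ g ∈ G, Commute z g) {i : ℕ} {f : G} (hf : f ∈ Subgroup.upperCentralSeries G (i + 1))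
    {g : HomeoR} (hg : g ∈ G) {x : ℝ} (hx : x ∈ centralFixSet G z i) :
    (f : HomeoR) (g x) = g ((f : HomeoR) x) := by
  have hinv := invariantUnder_centralFixSet hz i
  have h1 := (hinv g hg _ (hinv f f.2 x hx)).2 _
    (Subgroup.mem_upperCentralSeries_succ_iff.1 hf ⟨g, hg⟩)
  rw [← RelIso.mul_apply, ← RelIso.mul_apply] at h1
  rw [← h1, ← RelIso.mul_apply]
  congr 1
  rw [commutatorElement_def]
  push_cast
  group

theorem nilpotent_C1alpha_minimal (α : ℝ≥0) (hα : 0 < α)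
    (G : Subgroup HomeoR) (hnilp : Group.IsNilpotent ↥G)
    (hsmooth : ∀ g ∈ G, ContDiff ℝ 1 (⇑g) ∧ (∀ x : ℝ, deriv (⇑g) x ≠ 0) ∧
      ∀ K : Set ℝ, IsCompact K → ∃ C : ℝ≥0, HolderOnWith C α (deriv (⇑g)) K) :
    ∃ Λ : Set ℝ, MinimalSet G Λ := by
  classical
  by_contra hno
  have hG : ∀ x, ∃ g ∈ G, g x ≠ x := by
    by_contra! hcon
    obtain ⟨x, hx⟩ := hcon
    exact hno ⟨_, minimalSet_singleton hx⟩
  have hfix : ∀ g ∈ G, ∃ x, g x = x := by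
    intro g hg
    by_contra! hcon
    exact hno (exists_minimalSet_of_free hg hcon)
  have : Nontrivial G := by
    obtain ⟨g, hg, hgx⟩ := hG 0
    refine ⟨⟨g, hg⟩, 1, fun e => hgx ?_⟩
    have h1 : g = 1 := congrArg Subtype.val e
    rw [h1]
    rfl
  obtain ⟨⟨z, hzG⟩, hzc, hz1⟩ := exists_ne_one_mem_center (G := G)
  have hz : ∀ g ∈ G, Commute z g := fun g hg =>
    congrArg Subtype.val (Subgroup.mem_center_iff.1 hzc ⟨g, hg⟩).symm
  have hex : ∃ i, ¬ (centralFixSet G z i).Nonempty := by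
    obtain ⟨n, hn⟩ := Group.IsNilpotent.nilpotent G
    refine ⟨n, ?_⟩
    rintro ⟨x, -, hx⟩
    obtain ⟨g, hg, hgx⟩ := hG x
    exact hgx (hx ⟨g, hg⟩ (hn ▸ Subgroup.mem_top _))
  have hspec := Nat.find_spec hex
  rcases hi : Nat.find hex with _ | i
  · obtain ⟨x, hx⟩ := hfix z hzG
    rw [hi] at hspec
    refine hspec ⟨x, hx, fun g hg => ?_⟩
    rw [Subgroup.upperCentralSeries_zero, Subgroup.mem_bot] at hg
    rw [hg]
    rfl
  rw [hi] at hspec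
  have hne : (centralFixSet G z i).Nonempty := not_not.1 (Nat.find_min hex (by omega))
  have hinv := invariantUnder_centralFixSet hz i
  set A : Set HomeoR := Subtype.val '' (Subgroup.upperCentralSeries G (i + 1) : Set G) with hA
  have hAG : A ⊆ G := by
    rintro _ ⟨f, -, rfl⟩
    exact f.2
  have hcomm : ∀ f ∈ A, ∀ g ∈ G, ∀ x ∈ centralFixSet G z i, f (g x) = g (f x) := by
    rintro _ ⟨f, hf, rfl⟩ g hg x hx
    exact commute_on_centralFixSet hz hf hg hx
  obtain ⟨x₀, hx₀⟩ : ∃ x, z x ≠ x := by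
    by_contra! hcon
    exact hz1 (Subtype.ext (RelIso.ext hcon))
  obtain ⟨a, b, hgap, hax, hxb⟩ := exists_gap hG hne (isClosed_centralFixSet G z i) hinv
    (le_refl x₀) (fun _ _ hlt => hlt.le) (.inr fun hx => hx₀ hx.1)
  obtain ⟨f, p, q, htower, hfA, rfl, rfl⟩ := exists_tower hG hAG
    (by
      rintro _ ⟨f, hf, rfl⟩
      exact ⟨f⁻¹, inv_mem hf, rfl⟩)
    hcomm
    (by
      intro x hx
      by_contra! hcon
      exact hspec ⟨x, hx.1, fun g hg => hcon g ⟨g, hg, rfl⟩⟩)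
    (fun f hf => hfix f (hAG hf)) hgap
  have hfG : ∀ j, f j ∈ G := fun j => hAG (hfA j)
  obtain ⟨u, v, D, hD⟩ := htower.exists_bounded_distortion hα hsmooth hinv hfG
    (fun i j x hx => hcomm _ (hfA i) _ (hfG j) x hx) hgap.left_mem hgap.right_mem
  have hza : z (p 0) = p 0 := hgap.left_mem.1
  have hzb : z (q 0) = q 0 := hgap.right_mem.1
  have hinv_fix : ∀ x, z x = x → z⁻¹ x = x := fun x hx => by
    conv_lhs => rw [← hx]
    exact RelIso.inv_apply_self z x
  have hle := apply_le_of_bounded_distortion hsmooth hgap.lt hD hzG hz hza hzb ⟨hax, hxb⟩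
  have hge := apply_le_of_bounded_distortion hsmooth hgap.lt hD (inv_mem hzG)
    (fun g hg => (hz g hg).inv_left) (hinv_fix _ hza) (hinv_fix _ hzb) ⟨hax, hxb⟩
  have hge' := z.monotone hge
  rw [RelIso.apply_inv_self] at hge'
  exact hx₀ (le_antisymm hle hge')
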